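/- Let 0 < α ≤ 2, β ≥ 0, and let A generate a tempered (α,β)-ROF R_{α,β}. Then for x ∈ X: x ∈ closure(R(A)) if and only if lim_{t→∞} (I_{0+}^α R_{α,β}(·)x)(t) / t^{α+β} = 0. -/

import Mathlib

open MeasureTheory Set

/-- The Wright function `φ(ρ, μ; z) = ∑ z^k/(k! Γ(ρk+μ))`. -/
noncomputable def wright (ρ : ℝ) (μ : ℂ) (z : ℂ) : ℂ :=
  ∑' k : ℕ, z ^ k / ((k.factorial : ℂ) * Complex.Gamma ((ρ : ℂ) * k + μ))

/-- Bessel function of the first kind of real order `ν` at a real argument. -/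
noncomputable def besselJ (ν : ℝ) (x : ℝ) : ℝ :=
  (x / 2) ^ ν * ∑' k : ℕ, (-1 : ℝ) ^ k * (x / 2) ^ (2 * k) /
    ((k.factorial : ℝ) * Real.Gamma (ν + k + 1))

/-- Mittag-Leffler function. -/
noncomputable def mittagLeffler (a m : ℝ) (z : ℂ) : ℂ :=
  ∑' k : ℕ, z ^ k / Complex.Gamma ((a : ℂ) * k + m)

variable {X : Type*} [NormedAddCommGroup X] [NormedSpace ℂ X]

/-- `R` is the (bounded, everywhere-defined) resolvent `(z - A)⁻¹` of the
(possibly unbounded) linear operator `A`; i.e. `z ∈ ρ(A)`. -/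
structure IsResolventOf (A : X →ₗ.[ℂ] X) (z : ℂ) (R : X →L[ℂ] X) : Prop where
  mem : ∀ x : X, R x ∈ A.domain
  right : ∀ x : X, z • R x - A ⟨R x, mem x⟩ = x
  left : ∀ y : A.domain, R (z • (y : X) - A y) = y

/-- The open sector of half-angle `θ` around the positive real axis. -/
def sect (θ : ℝ) : Set ℂ := {z : ℂ | z ≠ 0 ∧ |Complex.arg z| < θ}

/-- `A` is sectorial of angle `ω`: the spectrum lies in the closed sector of angle `ω`
(resolvents exist outside) and `‖z(z-A)⁻¹‖` is uniformly bounded outside each bigger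
closed sector. -/
def IsSectorial (A : X →ₗ.[ℂ] X) (ω : ℝ) : Prop :=
  (∀ z ∈ (closure (sect ω))ᶜ, ∃ R : X →L[ℂ] X, IsResolventOf A z R) ∧
  ∀ ω' ∈ Set.Ioo ω Real.pi, ∃ M : ℝ,
    ∀ z ∈ (closure (sect ω'))ᶜ, ∀ R : X →L[ℂ] X, IsResolventOf A z R → ‖z‖ * ‖R‖ ≤ M

/-- `B = A⁻¹` as an unbounded operator. -/
def IsInverseOf (B A : X →ₗ.[ℂ] X) : Prop :=
  (∀ x : A.domain, ∃ h : A x ∈ B.domain, B ⟨A x, h⟩ = (x : X)) ∧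
  (∀ y : B.domain, ∃ h : B y ∈ A.domain, A ⟨B y, h⟩ = (y : X))

/-- Riemann–Liouville fractional integral of order `μ > 0`. -/
noncomputable def fracInt (μ : ℝ) (f : ℝ → X) (t : ℝ) : X :=
  ∫ s in Set.Ioo 0 t, ((t - s) ^ (μ - 1) / Real.Gamma μ) • f s

/-- `S` is a `β`-times integrated `α`-resolvent operator function generated by `A`,
with exponential bound `M e^{ω t}`. -/
structure IsROF (A : X →ₗ.[ℂ] X) (α β : ℝ) (S : ℝ → X →L[ℂ] X) (ω M : ℝ) : Prop where
  cont : ∀ x : X, ContinuousOn (fun t : ℝ => S t x) (Set.Ici 0)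
  bound : ∀ t : ℝ, 0 ≤ t → ‖S t‖ ≤ M * Real.exp (ω * t)
  laplace : ∀ l : ℝ, ω < l → ∃ R : X →L[ℂ] X,
    IsResolventOf A ((l ^ α : ℝ) : ℂ) R ∧
    ∀ x : X, ((l ^ (α - β - 1) : ℝ) : ℂ) • R x =
      ∫ t in Set.Ioi (0 : ℝ), Real.exp (-(l * t)) • S t x

/-- `S` is a tempered `β`-times integrated `α`-resolvent operator function generated
by `A`: `‖S t‖ ≤ M t^β` and the Laplace-transform identity holds for all `λ > 0`. -/
structure IsTemperedROF (A : X →ₗ.[ℂ] X) (α β : ℝ) (S : ℝ → X →L[ℂ] X) (M : ℝ) : Prop where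
  cont : ∀ x : X, ContinuousOn (fun t : ℝ => S t x) (Set.Ici 0)
  bound : ∀ t : ℝ, 0 ≤ t → ‖S t‖ ≤ M * t ^ β
  laplace : ∀ l : ℝ, 0 < l → ∃ R : X →L[ℂ] X,
    IsResolventOf A ((l ^ α : ℝ) : ℂ) R ∧
    ∀ x : X, ((l ^ (α - β - 1) : ℝ) : ℂ) • R x =
      ∫ t in Set.Ioi (0 : ℝ), Real.exp (-(l * t)) • S t x


open Filter Topology

/-- The Laplace kernel `s ↦ s ^ (μ - 1) * exp (-l s)` is integrable on the half-line. -/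
theorem integrableOn_rpow_mul_exp_neg_mul_Ioi {μ l : ℝ} (hμ : 0 < μ) (hl : 0 < l) :
    IntegrableOn (fun s : ℝ => s ^ (μ - 1) * Real.exp (-(l * s))) (Ioi 0) := by
  refine .of_integral_ne_zero ?_
  rw [Real.integral_rpow_mul_exp_neg_mul_Ioi hμ hl]
  have := Real.Gamma_pos_of_pos hμ
  positivity

theorem integrableOn_sub_rpow_Ioo {μ : ℝ} (hμ : 0 < μ) {t : ℝ} (ht : 0 < t) :
    IntegrableOn (fun s : ℝ => (t - s) ^ (μ - 1) / Real.Gamma μ) (Ioo 0 t) := by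
  have h := (intervalIntegral.intervalIntegrable_rpow' (a := 0) (b := t) (r := μ - 1)
    (by linarith)).comp_sub_left t
  simp only [sub_zero, sub_self] at h
  exact (((intervalIntegrable_iff_integrableOn_Ioc_of_le ht.le).1 h.symm).mono_set
    Ioo_subset_Ioc_self).div_const _

/-- Local integrability of the integrand defining the fractional integral. -/
theorem integrableOn_fracInt {μ : ℝ} (hμ : 0 < μ) {f : ℝ → X} (hf : ContinuousOn f (Ici 0))
    {t : ℝ} (ht : 0 < t) :
    IntegrableOn (fun s : ℝ => ((t - s) ^ (μ - 1) / Real.Gamma μ) • f s) (Ioo 0 t) :=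
  (integrableOn_sub_rpow_Ioo hμ ht).smul_continuousOn_of_subset
    (hf.mono Icc_subset_Ici_self) measurableSet_Ioo isCompact_Icc Ioo_subset_Icc_self

theorem fracInt_sub {μ : ℝ} (hμ : 0 < μ) {f g : ℝ → X} (hf : ContinuousOn f (Ici 0))
    (hg : ContinuousOn g (Ici 0)) {t : ℝ} (ht : 0 < t) :
    fracInt μ (fun s => f s - g s) t = fracInt μ f t - fracInt μ g t := by
  simp only [fracInt, smul_sub]
  exact integral_sub (integrableOn_fracInt hμ hf ht) (integrableOn_fracInt hμ hg ht)

/-- Rescaling the fractional integral to the unit interval. -/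
theorem fracInt_eq_rpow_smul (μ : ℝ) (f : ℝ → X) {t : ℝ} (ht : 0 < t) :
    fracInt μ f t =
      t ^ μ • ∫ r in Ioo (0 : ℝ) 1, ((1 - r) ^ (μ - 1) / Real.Gamma μ) • f (t * r) := by
  have h := intervalIntegral.smul_integral_comp_mul_left (a := 0) (b := 1)
    (fun s : ℝ => ((t - s) ^ (μ - 1) / Real.Gamma μ) • f s) t
  rw [mul_zero, mul_one, intervalIntegral.integral_of_le ht.le, integral_Ioc_eq_integral_Ioo,
    intervalIntegral.integral_of_le zero_le_one, integral_Ioc_eq_integral_Ioo] at h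
  rw [fracInt, ← h, ← integral_smul, ← integral_smul]
  refine setIntegral_congr_fun measurableSet_Ioo fun r hr => ?_
  have h1 : (t - t * r) ^ (μ - 1) = t ^ (μ - 1) * (1 - r) ^ (μ - 1) := by
    rw [← Real.mul_rpow ht.le (by linarith [hr.2])]
    ring_nf
  have h2 : t ^ μ = t * t ^ (μ - 1) := by
    rw [Real.rpow_sub_one ht.ne']
    field_simp
  simp only [smul_smul]
  rw [h1, h2]
  ring_nf

/-- The fractional integral of order `μ` raises polynomial growth by the exponent `μ`. -/
theorem exists_norm_fracInt_le {μ β : ℝ} (hμ : 0 < μ) (hβ : 0 ≤ β) :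
    ∃ C : ℝ, 0 ≤ C ∧ ∀ (f : ℝ → X) (K : ℝ), 0 ≤ K → (∀ s, 0 ≤ s → ‖f s‖ ≤ K * s ^ β) →
      ∀ t, 0 < t → ‖fracInt μ f t‖ ≤ C * K * t ^ (μ + β) := by
  have hΓ := Real.Gamma_pos_of_pos hμ
  have hnn : ∀ r ∈ Ioo (0 : ℝ) 1, 0 ≤ (1 - r) ^ (μ - 1) / Real.Gamma μ := fun r hr => by
    have : 0 ≤ 1 - r := by linarith [hr.2]
    positivity
  refine ⟨∫ r in Ioo (0 : ℝ) 1, (1 - r) ^ (μ - 1) / Real.Gamma μ,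
    setIntegral_nonneg measurableSet_Ioo hnn, fun f K hK hf t ht => ?_⟩
  rw [fracInt_eq_rpow_smul μ f ht, norm_smul, Real.norm_of_nonneg (by positivity),
    Real.rpow_add ht]
  have key : ‖∫ r in Ioo (0 : ℝ) 1, ((1 - r) ^ (μ - 1) / Real.Gamma μ) • f (t * r)‖ ≤
      ∫ r in Ioo (0 : ℝ) 1, (1 - r) ^ (μ - 1) / Real.Gamma μ * (K * t ^ β) := by
    refine norm_integral_le_of_norm_le
      ((integrableOn_sub_rpow_Ioo hμ one_pos).mul_const _) ?_
    refine (ae_restrict_iff' measurableSet_Ioo).2 (ae_of_all _ fun r hr => ?_)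
    rw [norm_smul, Real.norm_of_nonneg (hnn r hr)]
    refine mul_le_mul_of_nonneg_left ((hf _ (by nlinarith [hr.1])).trans ?_) (hnn r hr)
    have := Real.rpow_le_rpow (by nlinarith [hr.1]) (by nlinarith [hr.2] : t * r ≤ t) hβ
    gcongr
  rw [integral_mul_const] at key
  exact (mul_le_mul_of_nonneg_left key (by positivity)).trans_eq (by ring)

theorem continuousOn_fracInt {μ : ℝ} (hμ : 0 < μ) {f : ℝ → X}
    (hf : ContinuousOn f (Ici 0)) : ContinuousOn (fracInt μ f) (Ioi 0) := by
  suffices h : ContinuousOn (fun t : ℝ =>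
      ∫ r in Ioo (0 : ℝ) 1, ((1 - r) ^ (μ - 1) / Real.Gamma μ) • f (t * r)) (Ioi 0) by
    refine (ContinuousOn.smul (f := fun t : ℝ => t ^ μ) ?_ h).congr
      fun t ht => fracInt_eq_rpow_smul μ f ht
    exact fun t ht => (Real.continuousAt_rpow_const _ _ (Or.inl (ne_of_gt ht))).continuousWithinAt
  have hmul : ∀ t : ℝ, 0 < t → ∀ r ∈ Ioo (0 : ℝ) 1, t * r ∈ Icc 0 t := fun t ht r hr =>
    ⟨by nlinarith [hr.1], by nlinarith [hr.2]⟩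
  intro t₀ ht₀
  have ht₀' : (0 : ℝ) < t₀ := ht₀
  obtain ⟨C, hC⟩ := (isCompact_Icc (a := (0 : ℝ)) (b := t₀ + 1)).exists_bound_of_continuousOn
    (hf.mono Icc_subset_Ici_self)
  have hloc : ContinuousOn (fun t : ℝ =>
      ∫ r in Ioo (0 : ℝ) 1, ((1 - r) ^ (μ - 1) / Real.Gamma μ) • f (t * r))
      (Ioo 0 (t₀ + 1)) := by
    refine continuousOn_of_dominated
      (bound := fun r => ‖(1 - r) ^ (μ - 1) / Real.Gamma μ‖ * C) (fun t ht => ?_)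
      (fun t ht => (ae_restrict_iff' measurableSet_Ioo).2 (ae_of_all _ fun r hr => ?_))
      ((integrableOn_sub_rpow_Ioo hμ one_pos).norm.mul_const _)
      ((ae_restrict_iff' measurableSet_Ioo).2 (ae_of_all _ fun r hr => ?_))
    · refine (integrableOn_sub_rpow_Ioo hμ one_pos).aestronglyMeasurable.smul ?_
      refine ContinuousOn.aestronglyMeasurable (hf.comp (by fun_prop) fun r hr => ?_)
        measurableSet_Ioo
      exact (hmul t ht.1 r hr).1
    · rw [norm_smul]
      have := hmul t ht.1 r hr
      exact mul_le_mul_of_nonneg_left (hC _ ⟨this.1, this.2.trans ht.2.le⟩) (norm_nonneg _)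
    · exact continuousOn_const.smul
        (hf.comp (by fun_prop) fun t ht => (hmul t ht.1 r hr).1)
  exact (hloc.continuousAt (Ioo_mem_nhds ht₀' (by linarith))).continuousWithinAt

/-- The Laplace transform of `fracInt μ f` is `l ^ (-μ)` times the one of `f`. -/
theorem laplace_fracInt [CompleteSpace X] {μ l : ℝ} (hμ : 0 < μ) (hl : 0 < l) {f : ℝ → X}
    (hf : IntegrableOn (fun t => Real.exp (-(l * t)) • f t) (Ioi 0)) :
    IntegrableOn (fun t => Real.exp (-(l * t)) • fracInt μ f t) (Ioi 0) ∧
    ∫ t in Ioi (0 : ℝ), Real.exp (-(l * t)) • fracInt μ f t =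
      l ^ (-μ) • ∫ t in Ioi (0 : ℝ), Real.exp (-(l * t)) • f t := by
  have hΓ := Real.Gamma_pos_of_pos hμ
  let L : X →L[ℝ] ℝ →L[ℝ] X := (ContinuousLinearMap.lsmul ℝ ℝ).flip
  let g : ℝ → ℝ := fun s => s ^ (μ - 1) * Real.exp (-(l * s)) / Real.Gamma μ
  have hg : IntegrableOn g (Ioi 0) := (integrableOn_rpow_mul_exp_neg_mul_Ioi hμ hl).div_const _
  have hgi : ∫ s in Ioi (0 : ℝ), g s = l ^ (-μ) := by
    simp only [g]
    rw [integral_div, Real.integral_rpow_mul_exp_neg_mul_Ioi hμ hl, one_div, Real.inv_rpow hl.le,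
      Real.rpow_neg hl.le]
    field_simp
  have heq : ∀ t ∈ Ioi (0 : ℝ), ∫ s in (0 : ℝ)..t, L (Real.exp (-(l * s)) • f s) (g (t - s)) =
      Real.exp (-(l * t)) • fracInt μ f t := by
    intro t ht
    rw [intervalIntegral.integral_of_le (le_of_lt ht), integral_Ioc_eq_integral_Ioo, fracInt,
      ← integral_smul]
    refine setIntegral_congr_fun measurableSet_Ioo fun s _ => ?_
    simp only [L, g, ContinuousLinearMap.flip_apply, ContinuousLinearMap.lsmul_apply, smul_smul]
    congr 1
    rw [show -(l * t) = -(l * (t - s)) + -(l * s) by ring, Real.exp_add]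
    ring
  constructor
  · have h := (integrable_posConvolution hf hg L).integrableOn (s := Ioi 0)
    refine h.congr_fun (fun t ht => ?_) measurableSet_Ioi
    rw [posConvolution, indicator_of_mem ht]
    exact heq t ht
  · rw [← setIntegral_congr_fun measurableSet_Ioi heq, integral_posConvolution hf hg L, hgi]
    simp [L]

/-- A continuous compactly supported function on the open half-line is a uniform limit of
functions `t ↦ exp (-t) * p (exp (-t))` with `p` a polynomial. -/
theorem exists_polynomial_exp_near {g : ℝ → ℝ} (hg : Continuous g) (hgc : HasCompactSupport g)
    {ε : ℝ} (hε : 0 < ε) : ∃ p : Polynomial ℝ, ∀ t, 0 ≤ t →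
      |g t - Real.exp (-t) * p.eval (Real.exp (-t))| ≤ ε * Real.exp (-t) := by
  obtain ⟨T, hT⟩ : ∃ T : ℝ, ∀ t, T < t → g t = 0 := by
    obtain ⟨T, hT⟩ := hgc.isCompact.bddAbove
    exact ⟨T, fun t ht => image_eq_zero_of_notMem_tsupport fun h => (hT h).not_gt ht⟩
  have hc : Continuous fun u : ℝ => g (-Real.log u) / u := by
    rw [continuous_iff_continuousAt]
    intro u
    rcases eq_or_ne u 0 with rfl | hu
    · refine (continuousAt_const (y := (0 : ℝ))).congr ?_
      filter_upwards [Metric.ball_mem_nhds (0 : ℝ) (Real.exp_pos (-T))] with v hv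
      rcases eq_or_ne v 0 with rfl | hv0
      · simp
      · rw [hT, zero_div]
        have h1 : |v| < Real.exp (-T) := by simpa using hv
        have h2 := Real.log_lt_log (abs_pos.2 hv0) h1
        rw [Real.log_abs, Real.log_exp] at h2
        linarith
    · exact (hg.continuousAt.comp (Real.continuousAt_log hu).neg).div continuousAt_id hu
  obtain ⟨p, hp⟩ := exists_polynomial_near_of_continuousOn 0 1 _ hc.continuousOn ε hε
  refine ⟨p, fun t ht => ?_⟩
  have h := (hp (Real.exp (-t)) ⟨(Real.exp_pos _).le, Real.exp_le_one_iff.2 (by linarith)⟩).le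
  rw [Real.log_exp, neg_neg, abs_sub_comm] at h
  have he := Real.exp_pos (-t)
  calc _ = |Real.exp (-t) * (g t / Real.exp (-t) - p.eval (Real.exp (-t)))| := by
        congr 1
        field_simp
    _ = Real.exp (-t) * |g t / Real.exp (-t) - p.eval (Real.exp (-t))| := by
        rw [abs_mul, abs_of_pos he]
    _ ≤ _ := by
        rw [mul_comm]
        gcongr

/-- Uniqueness for the Laplace transform of continuous functions on the open half-line. -/
theorem eqOn_zero_of_laplace_eq_zero [CompleteSpace X] {f : ℝ → X} (hf : ContinuousOn f (Ioi 0))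
    (hint : ∀ l : ℝ, 0 < l → IntegrableOn (fun t => Real.exp (-(l * t)) • f t) (Ioi 0))
    (h0 : ∀ l : ℝ, 0 < l → ∫ t in Ioi (0 : ℝ), Real.exp (-(l * t)) • f t = 0) :
    EqOn f 0 (Ioi 0) := by
  have hpint : ∀ p : Polynomial ℝ, IntegrableOn
      (fun t => (Real.exp (-t) * p.eval (Real.exp (-t))) • f t) (Ioi 0) ∧
      ∫ t in Ioi (0 : ℝ), (Real.exp (-t) * p.eval (Real.exp (-t))) • f t = 0 := by
    intro p
    induction p using Polynomial.induction_on' with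
    | add p q hp hq =>
      simp only [Polynomial.eval_add, mul_add, add_smul]
      exact ⟨hp.1.add hq.1, by rw [integral_add hp.1 hq.1, hp.2, hq.2, add_zero]⟩
    | monomial n a =>
      have h : ∀ t : ℝ, (Real.exp (-t) * (Polynomial.monomial n a).eval (Real.exp (-t))) • f t =
          a • (Real.exp (-(((n : ℝ) + 1) * t)) • f t) := fun t => by
        rw [Polynomial.eval_monomial, smul_smul, ← Real.exp_nat_mul, mul_left_comm,
          ← Real.exp_add]
        ring_nf
      simp only [h]
      exact ⟨(hint _ (by positivity)).smul a,
        by rw [integral_smul, h0 _ (by positivity), smul_zero]⟩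
  have hint1 : IntegrableOn (fun t => Real.exp (-t) • f t) (Ioi 0) := by
    simpa using hint 1 one_pos
  have hae : ∀ᵐ t : ℝ, t ∈ Ioi (0 : ℝ) → f t = 0 := by
    refine isOpen_Ioi.ae_eq_zero_of_integral_contDiff_smul_eq_zero
      (hf.locallyIntegrableOn measurableSet_Ioi) fun g hg hgc hgs => ?_
    have hset : ∫ t, g t • f t = ∫ t in Ioi (0 : ℝ), g t • f t := by
      refine (setIntegral_eq_integral_of_forall_compl_eq_zero fun t ht => ?_).symm
      rw [image_eq_zero_of_notMem_tsupport fun h => ht (hgs h), zero_smul]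
    have hb : ∀ ε : ℝ, 0 < ε →
        ‖∫ t in Ioi (0 : ℝ), g t • f t‖ ≤ ε * ∫ t in Ioi (0 : ℝ), ‖Real.exp (-t) • f t‖ := by
      intro ε hε
      obtain ⟨p, hp⟩ := exists_polynomial_exp_near hg.continuous hgc hε
      have hle : ∀ t ∈ Ioi (0 : ℝ),
          ‖g t • f t - (Real.exp (-t) * p.eval (Real.exp (-t))) • f t‖ ≤
            ε * ‖Real.exp (-t) • f t‖ := fun t ht => by
        rw [← sub_smul, norm_smul, norm_smul, Real.norm_of_nonneg (Real.exp_pos _).le,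
          ← mul_assoc]
        exact mul_le_mul_of_nonneg_right (hp t (le_of_lt ht)) (norm_nonneg _)
      have hle' := (ae_restrict_iff' (μ := volume) measurableSet_Ioi).2 (ae_of_all _ hle)
      have hmeas : AEStronglyMeasurable (fun t => g t • f t) (volume.restrict (Ioi 0)) :=
        (hg.continuous.continuousOn.smul hf).aestronglyMeasurable measurableSet_Ioi
      have hd : IntegrableOn
          (fun t => g t • f t - (Real.exp (-t) * p.eval (Real.exp (-t))) • f t) (Ioi 0) :=
        (hint1.norm.const_mul ε).mono' (hmeas.sub (hpint p).1.aestronglyMeasurable) hle'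
      have heq : ∫ t in Ioi (0 : ℝ), g t • f t = ∫ t in Ioi (0 : ℝ),
          (g t • f t - (Real.exp (-t) * p.eval (Real.exp (-t))) • f t) := by
        have h := integral_add hd (hpint p).1
        simp only [sub_add_cancel] at h
        rw [h, (hpint p).2, add_zero]
      rw [heq, ← integral_const_mul]
      exact norm_integral_le_of_norm_le (hint1.norm.const_mul ε) hle'
    rw [hset, ← norm_le_zero_iff]
    have hlim : Tendsto (fun ε : ℝ => ε * ∫ t in Ioi (0 : ℝ), ‖Real.exp (-t) • f t‖)
        (𝓝[>] 0) (𝓝 0) := by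
      have := (continuous_mul_const (∫ t in Ioi (0 : ℝ), ‖Real.exp (-t) • f t‖)).tendsto 0
      rw [zero_mul] at this
      exact this.mono_left nhdsWithin_le_nhds
    exact ge_of_tendsto hlim (eventually_nhdsWithin_of_forall hb)
  exact Measure.eqOn_open_of_ae_eq ((ae_restrict_iff' measurableSet_Ioi).2 hae) isOpen_Ioi hf
    continuousOn_const

/-- Abelian theorem: if `f t = o(t ^ γ)` at infinity, then the Laplace transform of `f` is
`o(l ^ (-γ - 1))` at `0`. -/
theorem tendsto_rpow_smul_laplace {γ C : ℝ} (hγ : 0 < γ) {f : ℝ → X}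
    (hC : ∀ t, 0 < t → ‖f t‖ ≤ C * t ^ γ)
    (hf : Tendsto (fun t : ℝ => (t ^ γ)⁻¹ • f t) atTop (𝓝 0)) :
    Tendsto (fun l : ℝ => l ^ (γ + 1) • ∫ t in Ioi (0 : ℝ), Real.exp (-(l * t)) • f t)
      (𝓝[>] 0) (𝓝 0) := by
  have hC0 : 0 ≤ C := by simpa using (norm_nonneg _).trans (hC 1 one_pos)
  have hΓ : 0 < Real.Gamma (γ + 1) := Real.Gamma_pos_of_pos (by linarith)
  have hbound : ∀ ε : ℝ, 0 < ε → ∃ K : ℝ, ∀ t, 0 < t → ‖f t‖ ≤ ε * t ^ γ + K := by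
    intro ε hε
    obtain ⟨T, hT⟩ := (Metric.tendsto_atTop.1 hf) ε hε
    refine ⟨C * (max T 0) ^ γ, fun t ht => ?_⟩
    have htγ := Real.rpow_pos_of_pos ht γ
    rcases le_total T t with h | h
    · have h1 := hT t h
      rw [dist_zero_right, norm_smul, norm_inv, Real.norm_of_nonneg htγ.le,
        inv_mul_lt_iff₀ htγ] at h1
      have : 0 ≤ C * (max T 0) ^ γ := by positivity
      linarith
    · have h1 : t ^ γ ≤ (max T 0) ^ γ := Real.rpow_le_rpow ht.le (h.trans (le_max_left _ _)) hγ.le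
      have := hC t ht
      have := mul_le_mul_of_nonneg_left h1 hC0
      nlinarith
  rw [tendsto_zero_iff_norm_tendsto_zero, Metric.tendsto_nhds]
  intro δ hδ
  obtain ⟨K, hK⟩ := hbound (δ / 2 / Real.Gamma (γ + 1)) (by positivity)
  have hlim : Tendsto (fun l : ℝ => δ / 2 + K * l ^ γ) (𝓝[>] 0) (𝓝 (δ / 2)) := by
    have h1 := ((Real.continuousAt_rpow_const 0 γ (Or.inr hγ.le)).tendsto.const_mul K).const_add
      (δ / 2)
    rw [Real.zero_rpow hγ.ne', mul_zero, add_zero] at h1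
    exact h1.mono_left nhdsWithin_le_nhds
  filter_upwards [hlim.eventually (gt_mem_nhds (half_lt_self hδ)), self_mem_nhdsWithin]
    with l hlδ hl
  have hl : 0 < l := hl
  rw [dist_zero_right, norm_norm]
  refine lt_of_le_of_lt ?_ hlδ
  have i1 := integrableOn_rpow_mul_exp_neg_mul_Ioi (μ := γ + 1) (by linarith) hl
  have i2 := integrableOn_rpow_mul_exp_neg_mul_Ioi (μ := 1) one_pos hl
  have e1 := Real.integral_rpow_mul_exp_neg_mul_Ioi (a := γ + 1) (by linarith) hl
  have e2 := Real.integral_rpow_mul_exp_neg_mul_Ioi (a := 1) one_pos hl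
  simp only [add_sub_cancel_right, sub_self, Real.rpow_zero, one_mul, Real.rpow_one,
    Real.Gamma_one, mul_one] at i1 i2 e1 e2
  have key := norm_integral_le_of_norm_le (f := fun t => Real.exp (-(l * t)) • f t)
    ((i1.const_mul (δ / 2 / Real.Gamma (γ + 1))).add (i2.const_mul K))
    ((ae_restrict_iff' measurableSet_Ioi).2 (ae_of_all _ fun t ht => by
      simp only [Pi.add_apply]
      rw [norm_smul, Real.norm_of_nonneg (Real.exp_pos _).le]
      nlinarith [hK t ht, Real.exp_pos (-(l * t))]))
  simp only [Pi.add_apply] at key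
  rw [integral_add (i1.const_mul _) (i2.const_mul _), integral_const_mul, integral_const_mul, e1,
    e2, one_div, Real.inv_rpow hl.le] at key
  have hlγ := Real.rpow_pos_of_pos hl (γ + 1)
  rw [norm_smul, Real.norm_of_nonneg hlγ.le]
  refine (mul_le_mul_of_nonneg_left key hlγ.le).trans (le_of_eq ?_)
  rw [Real.rpow_add_one hl.ne']
  field_simp

namespace IsTemperedROF

variable {A : X →ₗ.[ℂ] X} {α β M : ℝ} {S : ℝ → X →L[ℂ] X}

/-- In a non-complete space the Bochner integral vanishes, which forces the resolvents to
vanish. -/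
theorem completeSpace (hS : IsTemperedROF A α β S M) : CompleteSpace X := by
  by_contra hX
  obtain ⟨R, hR, h⟩ := hS.laplace 1 one_pos
  have h0 : ∀ x : X, x = 0 := fun x => by
    have h1 := h x
    rw [integral_of_not_completeSpace hX] at h1
    have h2 : R x = 0 := by simpa using h1
    have h3 := hR.right x
    have h4 : (⟨R x, hR.mem x⟩ : A.domain) = 0 := Subtype.ext h2
    rw [h4, h2, LinearPMap.map_zero, smul_zero, sub_zero] at h3
    exact h3.symm
  have : Subsingleton X := ⟨fun x y => (h0 x).trans (h0 y).symm⟩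
  exact hX inferInstance

theorem bound_nonneg (hS : IsTemperedROF A α β S M) : 0 ≤ M := by
  simpa using (norm_nonneg _).trans (hS.bound 1 zero_le_one)

theorem norm_apply_le (hS : IsTemperedROF A α β S M) (x : X) (t : ℝ) (ht : 0 ≤ t) :
    ‖S t x‖ ≤ M * ‖x‖ * t ^ β :=
  ((S t).le_of_opNorm_le (hS.bound t ht) x).trans_eq (by ring)

theorem integrableOn_laplace (hS : IsTemperedROF A α β S M) (hβ : 0 ≤ β) (x : X) {l : ℝ}
    (hl : 0 < l) : IntegrableOn (fun t => Real.exp (-(l * t)) • S t x) (Ioi 0) := by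
  have h := (integrableOn_rpow_mul_exp_neg_mul_Ioi (μ := β + 1) (by linarith) hl).const_mul
    (M * ‖x‖)
  refine h.mono' (ContinuousOn.aestronglyMeasurable (ContinuousOn.smul
    (f := fun t : ℝ => Real.exp (-(l * t))) (by fun_prop)
    ((hS.cont x).mono Ioi_subset_Ici_self)) measurableSet_Ioi)
    ((ae_restrict_iff' measurableSet_Ioi).2 (ae_of_all _ fun t ht => ?_))
  rw [norm_smul, Real.norm_of_nonneg (Real.exp_pos _).le, add_sub_cancel_right]
  calc _ ≤ Real.exp (-(l * t)) * (M * ‖x‖ * t ^ β) := by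
        gcongr
        exact hS.norm_apply_le x t (le_of_lt ht)
    _ = _ := by ring

/-- On the domain of the generator, integrating `S` fractionally after applying `A` undoes `A`
up to the initial value. -/
theorem fracInt_apply_generator (hS : IsTemperedROF A α β S M) (hα : 0 < α) (hβ : 0 ≤ β)
    (y : A.domain) {t : ℝ} (ht : 0 < t) :
    fracInt α (fun s => S s (A y)) t =
      S t (y : X) - (t ^ β / Real.Gamma (β + 1)) • (y : X) := by
  have := hS.completeSpace
  have hΓ : 0 < Real.Gamma (β + 1) := Real.Gamma_pos_of_pos (by linarith)
  have hpow : ∀ l : ℝ, 0 < l →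
      IntegrableOn (fun t : ℝ => Real.exp (-(l * t)) • ((t ^ β / Real.Gamma (β + 1)) • (y : X)))
        (Ioi 0) ∧
      ∫ t in Ioi (0 : ℝ), Real.exp (-(l * t)) • ((t ^ β / Real.Gamma (β + 1)) • (y : X)) =
        l ^ (-(β + 1)) • (y : X) := by
    intro l hl
    have i := integrableOn_rpow_mul_exp_neg_mul_Ioi (μ := β + 1) (by linarith) hl
    have e := Real.integral_rpow_mul_exp_neg_mul_Ioi (a := β + 1) (by linarith) hl
    simp only [add_sub_cancel_right] at i e
    have hr : ∀ t : ℝ, Real.exp (-(l * t)) • ((t ^ β / Real.Gamma (β + 1)) • (y : X)) =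
        (t ^ β * Real.exp (-(l * t)) / Real.Gamma (β + 1)) • (y : X) := fun t => by
      rw [smul_smul]
      ring_nf
    simp only [hr]
    refine ⟨(i.div_const _).smul_const _, ?_⟩
    rw [integral_smul_const, integral_div, e, one_div, Real.inv_rpow hl.le, Real.rpow_neg hl.le]
    congr 1
    field_simp
  have hL := fun l (hl : (0 : ℝ) < l) =>
    laplace_fracInt hα hl (hS.integrableOn_laplace hβ (A y) hl)
  have hzero := eqOn_zero_of_laplace_eq_zero
    (f := fun t => fracInt α (fun s => S s (A y)) t -
      (S t (y : X) - (t ^ β / Real.Gamma (β + 1)) • (y : X))) ?_ ?_ ?_ ht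
  · exact sub_eq_zero.1 hzero
  · refine (continuousOn_fracInt hα (hS.cont _)).sub
      (((hS.cont _).mono Ioi_subset_Ici_self).sub
        (ContinuousOn.smul (f := fun t : ℝ => t ^ β / Real.Gamma (β + 1)) ?_ continuousOn_const))
    exact (Real.continuous_rpow_const hβ).continuousOn.div_const _
  · intro l hl
    simp only [smul_sub]
    exact (hL l hl).1.sub ((hS.integrableOn_laplace hβ _ hl).sub (hpow l hl).1)
  · intro l hl
    simp only [smul_sub]
    obtain ⟨R, hR, hlap⟩ := hS.laplace l hl
    have h2 := hR.left y
    simp only [Complex.coe_smul] at hlap h2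
    rw [map_sub, map_real_smul R R.continuous] at h2
    have hd := (hS.integrableOn_laplace hβ y hl).sub (hpow l hl).1
    rw [integral_sub (hL l hl).1 (by exact hd),
      integral_sub (hS.integrableOn_laplace hβ _ hl) (hpow l hl).1, (hL l hl).2, (hpow l hl).2,
      ← hlap, ← hlap, ← sub_eq_of_eq_add (sub_eq_iff_eq_add'.1 h2), smul_sub, smul_sub, smul_smul,
      smul_smul, smul_smul, ← Real.rpow_add hl, ← Real.rpow_add hl]
    ring_nf
    simp

end IsTemperedROF

theorem stmt16 {X : Type*} [NormedAddCommGroup X] [NormedSpace ℂ X]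
    (A : X →ₗ.[ℂ] X) (alpha beta M : ℝ) (halpha0 : 0 < alpha) (halpha2 : alpha ≤ 2)
    (hbeta : 0 ≤ beta)
    (S : ℝ → X →L[ℂ] X) (hS : IsTemperedROF A alpha beta S M) :
    ∀ x : X, x ∈ closure (Set.range fun y : A.domain => A y) ↔
      Filter.Tendsto (fun t : ℝ => (t ^ (alpha + beta))⁻¹ • fracInt alpha (fun s => S s x) t)
        Filter.atTop (nhds 0) := by
  intro x
  have := hS.completeSpace
  have hγ : 0 < alpha + beta := by linarith
  obtain ⟨C, hC0, hC⟩ := exists_norm_fracInt_le (X := X) halpha0 hbeta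
  have hCS : ∀ x : X, ∀ t, 0 < t →
      ‖fracInt alpha (fun s => S s x) t‖ ≤ C * (M * ‖x‖) * t ^ (alpha + beta) := fun x =>
    hC _ _ (mul_nonneg hS.bound_nonneg (norm_nonneg x)) (hS.norm_apply_le x)
  constructor
  · intro hx
    have hlim : ∀ y : A.domain, Tendsto
        (fun t : ℝ => (t ^ (alpha + beta))⁻¹ • fracInt alpha (fun s => S s (A y)) t)
        atTop (𝓝 0) := by
      intro y
      set D : ℝ := M * ‖(y : X)‖ + ‖(y : X)‖ / Real.Gamma (beta + 1)
      have hΓ : 0 < Real.Gamma (beta + 1) := Real.Gamma_pos_of_pos (by linarith)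
      refine squeeze_zero_norm' (a := fun t : ℝ => D * t ^ (-alpha)) ?_ ?_
      · filter_upwards [eventually_gt_atTop 0] with t ht
        rw [hS.fracInt_apply_generator halpha0 hbeta y ht, norm_smul, norm_inv,
          Real.norm_of_nonneg (by positivity), Real.rpow_add ht, Real.rpow_neg ht.le]
        have h1 : ‖S t (y : X) - (t ^ beta / Real.Gamma (beta + 1)) • (y : X)‖ ≤
            D * t ^ beta := by
          refine (norm_sub_le _ _).trans ?_
          rw [norm_smul, Real.norm_of_nonneg (by positivity)]
          refine (add_le_add_left (hS.norm_apply_le _ t ht.le) _).trans (le_of_eq ?_)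
          simp only [D]
          ring
        refine (mul_le_mul_of_nonneg_left h1 (by positivity)).trans (le_of_eq ?_)
        have := (Real.rpow_pos_of_pos ht beta).ne'
        field_simp
      · simpa using (tendsto_rpow_neg_atTop halpha0).const_mul D
    rw [Metric.tendsto_nhds]
    intro ε hε
    have hCM : 0 ≤ C * M := mul_nonneg hC0 hS.bound_nonneg
    obtain ⟨_, ⟨y, rfl⟩, hy⟩ := Metric.mem_closure_iff.1 hx (ε / 2 / (C * M + 1)) (by positivity)
    filter_upwards [(Metric.tendsto_nhds.1 (hlim y)) (ε / 2) (by positivity),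
      eventually_gt_atTop 0] with t ht ht0
    have htγ := Real.rpow_pos_of_pos ht0 (alpha + beta)
    rw [dist_zero_right] at ht ⊢
    have hsub := fracInt_sub halpha0 (hS.cont x) (hS.cont (A y)) ht0
    simp only [← map_sub] at hsub
    have hb := hCS (x - A y) t ht0
    rw [← sub_add_cancel (fracInt alpha (fun s => S s x) t) (fracInt alpha (fun s => S s (A y)) t),
      ← hsub, smul_add]
    refine (norm_add_le _ _).trans_lt ?_
    have h1 : ‖(t ^ (alpha + beta))⁻¹ • fracInt alpha (fun s => S s (x - A y)) t‖ ≤ ε / 2 := by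
      rw [norm_smul, norm_inv, Real.norm_of_nonneg htγ.le, inv_mul_le_iff₀ htγ]
      rw [dist_eq_norm, lt_div_iff₀ (by positivity)] at hy
      refine hb.trans ?_
      rw [mul_comm]
      gcongr
      nlinarith [norm_nonneg (x - A y)]
    linarith
  · intro h
    have hab := tendsto_rpow_smul_laplace hγ (hCS x) h
    rw [Metric.mem_closure_iff]
    intro ε hε
    obtain ⟨l, hlε, hl⟩ := ((Metric.tendsto_nhds.1 hab ε hε).and self_mem_nhdsWithin).exists
    have hl : 0 < l := hl
    obtain ⟨R, hR, hlap⟩ := hS.laplace l hl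
    rw [(laplace_fracInt halpha0 hl (hS.integrableOn_laplace hbeta x hl)).2, ← hlap,
      Complex.coe_smul, smul_smul, smul_smul, dist_zero_right, ← Real.rpow_add hl,
      ← Real.rpow_add hl] at hlε
    refine ⟨_, ⟨-⟨R x, hR.mem x⟩, rfl⟩, ?_⟩
    have h3 := hR.right x
    rw [Complex.coe_smul] at h3
    simp only [LinearPMap.map_neg]
    rw [dist_eq_norm, sub_neg_eq_add, ← sub_eq_iff_eq_add.1 h3]
    convert! hlε using 3
    ring_nf
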